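/- arXiv:2008.13356 — 5 statements merged into one kernel-verified Lean document; each statement's English description precedes it below -/
import Mathlib

section
/- Let ⟨P,V⟩ and ⟨Q,V⟩ be states of the process algebra with global variables such that all states reachable from them are image-finite. If ⟨P,V⟩ and ⟨Q,V⟩ satisfy exactly the same HML^{check} formulas, then ⟨P,V⟩ and ⟨Q,V⟩ are state-based bisimilar. -/
namespace GlobalVars

open scoped Classical

/-! ## The process algebra with global variables -/

/-- Transition labels: actions and assignments `assign(v,d)`. -/
inductive Label (D Var Act : Type) : Type
  | act : Act → Label D Var Act
  | assign : Var → D → Label D Var Act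

/-- Process expressions of the process algebra with global variables. -/
inductive PExp (D Var Act PN : Type) : Type
  | pre : Label D Var Act → PExp D Var Act PN → PExp D Var Act PN
  | delta : PExp D Var Act PN
  | choice : PExp D Var Act PN → PExp D Var Act PN → PExp D Var Act PN
  | par : PExp D Var Act PN → PExp D Var Act PN → PExp D Var Act PN
  | encaps : Set Act → PExp D Var Act PN → PExp D Var Act PN
  | name : PN → PExp D Var Act PN
  | cond : Var → D → PExp D Var Act PN → PExp D Var Act PN

/-- Valuations of the global variables. -/
abbrev Valuation (D Var : Type) := Var → D

variable {D Var Act PN : Type}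

/-- Every occurrence of a process name is in the scope of an action prefix. -/
def GuardedExp : PExp D Var Act PN → Prop
  | .pre _ _ => True
  | .delta => True
  | .choice P Q => GuardedExp P ∧ GuardedExp Q
  | .par P Q => GuardedExp P ∧ GuardedExp Q
  | .encaps _ P => GuardedExp P
  | .name _ => False
  | .cond _ _ P => GuardedExp P

/-- A guarded recursive specification. -/
def Guarded (spec : PN → PExp D Var Act PN) : Prop := ∀ X, GuardedExp (spec X)

/-- A label is not blocked by the encapsulation set `B ⊆ Act`. -/
def Label.allowedBy (B : Set Act) : Label D Var Act → Prop
  | .act a => a ∉ B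
  | .assign _ _ => True

/-- A partial binary communication function on actions. -/
def CommFun (Act : Type) : Type := Act → Act → Option Act

/-- Commutativity of the communication function. -/
def CommFun.Commutative (γ : CommFun Act) : Prop := ∀ a b, γ a b = γ b a

/-- Associativity of the communication function. -/
def CommFun.Associative (γ : CommFun Act) : Prop :=
  ∀ a b c, (γ a b).bind (fun x => γ x c) = (γ b c).bind (fun x => γ a x)

/-- Only handshaking communication: results of communications do not communicate further. -/
def CommFun.Handshaking (γ : CommFun Act) : Prop :=
  ∀ a b c, γ a b = some c → ∀ d, γ c d = none

/-- The structural operational semantics of the process algebra with global variables. -/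
inductive Trans [DecidableEq Var] (spec : PN → PExp D Var Act PN) (γ : CommFun Act) :
    PExp D Var Act PN → Valuation D Var → Label D Var Act →
    PExp D Var Act PN → Valuation D Var → Prop
  | pref (a : Act) (P : PExp D Var Act PN) (V : Valuation D Var) :
      Trans spec γ (.pre (.act a) P) V (.act a) P V
  | asgn (v : Var) (d : D) (P : PExp D Var Act PN) (V : Valuation D Var) :
      Trans spec γ (.pre (.assign v d) P) V (.assign v d) P (Function.update V v d)
  | cond (v : Var) (d : D) (P : PExp D Var Act PN) (V : Valuation D Var) (l : Label D Var Act)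
      (P' : PExp D Var Act PN) (V' : Valuation D Var) :
      V v = d → Trans spec γ P V l P' V' → Trans spec γ (.cond v d P) V l P' V'
  | recursion (X : PN) (V : Valuation D Var) (l : Label D Var Act) (P' : PExp D Var Act PN)
      (V' : Valuation D Var) :
      Trans spec γ (spec X) V l P' V' → Trans spec γ (.name X) V l P' V'
  | sumL (P Q : PExp D Var Act PN) (V : Valuation D Var) (l : Label D Var Act)
      (P' : PExp D Var Act PN) (V' : Valuation D Var) :
      Trans spec γ P V l P' V' → Trans spec γ (.choice P Q) V l P' V'
  | sumR (P Q : PExp D Var Act PN) (V : Valuation D Var) (l : Label D Var Act)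
      (Q' : PExp D Var Act PN) (V' : Valuation D Var) :
      Trans spec γ Q V l Q' V' → Trans spec γ (.choice P Q) V l Q' V'
  | parL (P Q : PExp D Var Act PN) (V : Valuation D Var) (l : Label D Var Act)
      (P' : PExp D Var Act PN) (V' : Valuation D Var) :
      Trans spec γ P V l P' V' → Trans spec γ (.par P Q) V l (.par P' Q) V'
  | parR (P Q : PExp D Var Act PN) (V : Valuation D Var) (l : Label D Var Act)
      (Q' : PExp D Var Act PN) (V' : Valuation D Var) :
      Trans spec γ Q V l Q' V' → Trans spec γ (.par P Q) V l (.par P Q') V'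
  | comm (P Q : PExp D Var Act PN) (V : Valuation D Var) (a b c : Act)
      (P' Q' : PExp D Var Act PN) :
      γ a b = some c → Trans spec γ P V (.act a) P' V → Trans spec γ Q V (.act b) Q' V →
      Trans spec γ (.par P Q) V (.act c) (.par P' Q') V
  | encaps (B : Set Act) (P : PExp D Var Act PN) (V : Valuation D Var) (l : Label D Var Act)
      (P' : PExp D Var Act PN) (V' : Valuation D Var) :
      l.allowedBy B → Trans spec γ P V l P' V' →
      Trans spec γ (.encaps B P) V l (.encaps B P') V'

/-- States of the induced labelled transition system. -/
abbrev GState (D Var Act PN : Type) := PExp D Var Act PN × Valuation D Var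

/-- The transition relation on states. -/
def STrans [DecidableEq Var] (spec : PN → PExp D Var Act PN) (γ : CommFun Act) :
    GState D Var Act PN → Label D Var Act → GState D Var Act PN → Prop :=
  fun s l s' => Trans spec γ s.1 s.2 l s'.1 s'.2

/-! ## Bisimulations -/

/-- A strong bisimulation on an LTS with states `S` and labels `L`. -/
def IsBisim {S L : Type} (tr : S → L → S → Prop) (R : S → S → Prop) : Prop :=
  ∀ s t, R s t → ∀ l : L,
    (∀ s', tr s l s' → ∃ t', tr t l t' ∧ R s' t') ∧
    (∀ t', tr t l t' → ∃ s', tr s l s' ∧ R s' t')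

/-- Strong bisimilarity. -/
def Bisimilar {S L : Type} (tr : S → L → S → Prop) (s t : S) : Prop :=
  ∃ R, IsBisim tr R ∧ R s t

/-- A stateless bisimulation on process expressions. -/
def IsStatelessBisim [DecidableEq Var] (spec : PN → PExp D Var Act PN) (γ : CommFun Act)
    (R : PExp D Var Act PN → PExp D Var Act PN → Prop) : Prop :=
  ∀ P Q, R P Q → ∀ (l : Label D Var Act) (V V' : Valuation D Var),
    (∀ P', Trans spec γ P V l P' V' → ∃ Q', Trans spec γ Q V l Q' V' ∧ R P' Q') ∧
    (∀ Q', Trans spec γ Q V l Q' V' → ∃ P', Trans spec γ P V l P' V' ∧ R P' Q')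

/-- Stateless bisimilarity of process expressions. -/
def StatelessBisimilar [DecidableEq Var] (spec : PN → PExp D Var Act PN) (γ : CommFun Act)
    (P Q : PExp D Var Act PN) : Prop :=
  ∃ R, IsStatelessBisim spec γ R ∧ R P Q

/-- A state-based bisimulation on states. -/
def IsStateBasedBisim [DecidableEq Var] (spec : PN → PExp D Var Act PN) (γ : CommFun Act)
    (R : GState D Var Act PN → GState D Var Act PN → Prop) : Prop :=
  ∀ (P : PExp D Var Act PN) (V₁ : Valuation D Var) (Q : PExp D Var Act PN)
    (V₂ : Valuation D Var), R (P, V₁) (Q, V₂) →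
    V₁ = V₂ ∧ ∀ (l : Label D Var Act) (V' : Valuation D Var),
      (∀ P', Trans spec γ P V₁ l P' V' →
        ∃ Q', Trans spec γ Q V₂ l Q' V' ∧ R (P', V') (Q', V')) ∧
      (∀ Q', Trans spec γ Q V₂ l Q' V' →
        ∃ P', Trans spec γ P V₁ l P' V' ∧ R (P', V') (Q', V'))

/-- State-based bisimilarity of states. -/
def StateBasedBisimilar [DecidableEq Var] (spec : PN → PExp D Var Act PN) (γ : CommFun Act)
    (s t : GState D Var Act PN) : Prop :=
  ∃ R, IsStateBasedBisim spec γ R ∧ R s t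

/-! ## Reachability and image-finiteness -/

/-- Reachability of states in an arbitrary LTS. -/
def ReachableState {S L : Type} (tr : S → L → S → Prop) : S → S → Prop :=
  Relation.ReflTransGen (fun s s' => ∃ l, tr s l s')

/-- Reachability of process expressions (via transitions for some valuations). -/
def ReachableProc [DecidableEq Var] (spec : PN → PExp D Var Act PN) (γ : CommFun Act) :
    PExp D Var Act PN → PExp D Var Act PN → Prop :=
  Relation.ReflTransGen
    (fun P P' => ∃ (V : Valuation D Var) (l : Label D Var Act) (V' : Valuation D Var),
      Trans spec γ P V l P' V')

/-- Image-finiteness of a state of an arbitrary LTS. -/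
def ImageFiniteState {S L : Type} (tr : S → L → S → Prop) (s : S) : Prop :=
  ∀ l : L, {s' | tr s l s'}.Finite

/-- Image-finiteness of a process expression. -/
def ImageFiniteProc [DecidableEq Var] (spec : PN → PExp D Var Act PN) (γ : CommFun Act)
    (P : PExp D Var Act PN) : Prop :=
  ∀ P', ReachableProc spec γ P P' → ∀ V : Valuation D Var,
    ImageFiniteState (STrans spec γ) (P', V)

/-! ## Hennessy–Milner logics -/

/-- Plain Hennessy–Milner logic over a type `L` of transition labels
(the modalities carry nonempty finite sets of labels). -/
inductive HMLb (L : Type) : Type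
  | tt : HMLb L
  | ff : HMLb L
  | neg : HMLb L → HMLb L
  | conj : HMLb L → HMLb L → HMLb L
  | disj : HMLb L → HMLb L → HMLb L
  | dia : (T : Set L) → T.Finite → T.Nonempty → HMLb L → HMLb L
  | box : (T : Set L) → T.Finite → T.Nonempty → HMLb L → HMLb L

/-- Satisfaction of plain HML in a state of an LTS. -/
def HMLb.Sat {S L : Type} (tr : S → L → S → Prop) : HMLb L → S → Prop
  | .tt, _ => True
  | .ff, _ => False
  | .neg φ, s => ¬ HMLb.Sat tr φ s
  | .conj φ ψ, s => HMLb.Sat tr φ s ∧ HMLb.Sat tr ψ s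
  | .disj φ ψ, s => HMLb.Sat tr φ s ∨ HMLb.Sat tr ψ s
  | .dia T _ _ φ, s => ∃ l ∈ T, ∃ s', tr s l s' ∧ HMLb.Sat tr φ s'
  | .box T _ _ φ, s => ∀ l ∈ T, ∀ s', tr s l s' → HMLb.Sat tr φ s'

/-- `HML^{check}`: HML extended with the check operator `(v = e)`. -/
inductive HMLc (D Var L : Type) : Type
  | tt : HMLc D Var L
  | ff : HMLc D Var L
  | check : Var → D → HMLc D Var L
  | neg : HMLc D Var L → HMLc D Var L
  | conj : HMLc D Var L → HMLc D Var L → HMLc D Var L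
  | disj : HMLc D Var L → HMLc D Var L → HMLc D Var L
  | dia : (T : Set L) → T.Finite → T.Nonempty → HMLc D Var L → HMLc D Var L
  | box : (T : Set L) → T.Finite → T.Nonempty → HMLc D Var L → HMLc D Var L

/-- Satisfaction of `HML^{check}` in a state consisting of a process and a valuation. -/
def HMLc.Sat {Pr L : Type}
    (tr : (Pr × Valuation D Var) → L → (Pr × Valuation D Var) → Prop) :
    HMLc D Var L → (Pr × Valuation D Var) → Prop
  | .tt, _ => True
  | .ff, _ => False
  | .check v e, s => s.2 v = e
  | .neg φ, s => ¬ HMLc.Sat tr φ s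
  | .conj φ ψ, s => HMLc.Sat tr φ s ∧ HMLc.Sat tr ψ s
  | .disj φ ψ, s => HMLc.Sat tr φ s ∨ HMLc.Sat tr ψ s
  | .dia T _ _ φ, s => ∃ l ∈ T, ∃ s', tr s l s' ∧ HMLc.Sat tr φ s'
  | .box T _ _ φ, s => ∀ l ∈ T, ∀ s', tr s l s' → HMLc.Sat tr φ s'

/-- `HML^{check+set}`: HML extended with the check operator `(v = e)` and the
set operator `↓(v := e)`. -/
inductive HMLcs (D Var L : Type) : Type
  | tt : HMLcs D Var L
  | ff : HMLcs D Var L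
  | check : Var → D → HMLcs D Var L
  | neg : HMLcs D Var L → HMLcs D Var L
  | conj : HMLcs D Var L → HMLcs D Var L → HMLcs D Var L
  | disj : HMLcs D Var L → HMLcs D Var L → HMLcs D Var L
  | dia : (T : Set L) → T.Finite → T.Nonempty → HMLcs D Var L → HMLcs D Var L
  | box : (T : Set L) → T.Finite → T.Nonempty → HMLcs D Var L → HMLcs D Var L
  | set : Var → D → HMLcs D Var L → HMLcs D Var L

/-- Satisfaction of `HML^{check+set}` in a state consisting of a process and a valuation. -/
def HMLcs.Sat {Pr L : Type} [DecidableEq Var]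
    (tr : (Pr × Valuation D Var) → L → (Pr × Valuation D Var) → Prop) :
    HMLcs D Var L → (Pr × Valuation D Var) → Prop
  | .tt, _ => True
  | .ff, _ => False
  | .check v e, s => s.2 v = e
  | .neg φ, s => ¬ HMLcs.Sat tr φ s
  | .conj φ ψ, s => HMLcs.Sat tr φ s ∧ HMLcs.Sat tr ψ s
  | .disj φ ψ, s => HMLcs.Sat tr φ s ∨ HMLcs.Sat tr ψ s
  | .dia T _ _ φ, s => ∃ l ∈ T, ∃ s', tr s l s' ∧ HMLcs.Sat tr φ s'
  | .box T _ _ φ, s => ∀ l ∈ T, ∀ s', tr s l s' → HMLcs.Sat tr φ s'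
  | .set v e φ, s => HMLcs.Sat tr φ (s.1, Function.update s.2 v e)

/-! ## The mCRL2 fragment -/

/-- Action labels of the mCRL2 fragment used for the translation. -/
inductive MAct (D Var Act : Type) : Type
  | act : Act → MAct D Var Act
  | checkP : D → Bool → MAct D Var Act
  | checkG : D → Bool → MAct D Var Act
  | check : D → Bool → MAct D Var Act
  | assignP : Var → D → MAct D Var Act
  | assignG : Var → D → MAct D Var Act
  | assign : Var → D → MAct D Var Act
  | value : Var → D → MAct D Var Act

/-- Action names of the mCRL2 fragment. -/
inductive MName (Act : Type) : Type
  | act : Act → MName Act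
  | checkP : MName Act
  | checkG : MName Act
  | check : MName Act
  | assignP : MName Act
  | assignG : MName Act
  | assign : MName Act
  | value : MName Act

/-- The name of an action label. -/
def MAct.name : MAct D Var Act → MName Act
  | .act a => .act a
  | .checkP _ _ => .checkP
  | .checkG _ _ => .checkG
  | .check _ _ => .check
  | .assignP _ _ => .assignP
  | .assignG _ _ => .assignG
  | .assign _ _ => .assign
  | .value _ _ => .value

/-- mCRL2 process expressions of the fragment needed for the translation.
Multi-action prefixes carry semantic multi-actions (finite multisets of action labels);
`comm` is the communication operator `Γ_{C_{Gγ}}`. -/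
inductive MProc (D Var Act N : Type) : Type
  | pre : Multiset (MAct D Var Act) → MProc D Var Act N → MProc D Var Act N
  | delta : MProc D Var Act N
  | choice : MProc D Var Act N → MProc D Var Act N → MProc D Var Act N
  | par : MProc D Var Act N → MProc D Var Act N → MProc D Var Act N
  | allow : Set (Multiset (MName Act)) → MProc D Var Act N → MProc D Var Act N
  | name : N → MProc D Var Act N
  | sum : (D → MProc D Var Act N) → MProc D Var Act N
  | hide : Set (MName Act) → MProc D Var Act N → MProc D Var Act N
  | comm : MProc D Var Act N → MProc D Var Act N

/-- The effect of hiding the action names in `I` on a semantic multi-action. -/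
noncomputable def hideM (I : Set (MName Act)) (α : Multiset (MAct D Var Act)) :
    Multiset (MAct D Var Act) :=
  α.filter (fun a => a.name ∉ I)

/-- A single application of one of the communications in
`C_{Gγ} = C_γ ∪ {assignP|assignG → assign, checkP|checkG → check}` to a semantic
multi-action (data parameters must match). -/
inductive CommStep (γ : CommFun Act) :
    Multiset (MAct D Var Act) → Multiset (MAct D Var Act) → Prop
  | act (a b c : Act) (rest : Multiset (MAct D Var Act)) : γ a b = some c →
      CommStep γ (MAct.act a ::ₘ MAct.act b ::ₘ rest) (MAct.act c ::ₘ rest)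
  | assign (v : Var) (d : D) (rest : Multiset (MAct D Var Act)) :
      CommStep γ (MAct.assignP v d ::ₘ MAct.assignG v d ::ₘ rest) (MAct.assign v d ::ₘ rest)
  | check (d : D) (b : Bool) (rest : Multiset (MAct D Var Act)) :
      CommStep γ (MAct.checkP d b ::ₘ MAct.checkG d b ::ₘ rest) (MAct.check d b ::ₘ rest)

/-- `γ_{C_{Gγ}}(α) = β`: the communications are applied exhaustively to `α`, yielding `β`. -/
def CommApply (γ : CommFun Act) (α β : Multiset (MAct D Var Act)) : Prop :=
  Relation.ReflTransGen (CommStep γ) α β ∧ ∀ β', ¬ CommStep γ β β'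

/-- The structural operational semantics of the mCRL2 fragment, for a recursive
specification `mspec` assigning a defining process to every (parametrized) process name. -/
inductive MTrans {N : Type} (mspec : N → MProc D Var Act N) (γ : CommFun Act) :
    MProc D Var Act N → Multiset (MAct D Var Act) → MProc D Var Act N → Prop
  | pre (α : Multiset (MAct D Var Act)) (P : MProc D Var Act N) :
      MTrans mspec γ (.pre α P) α P
  | sumL (P Q P' : MProc D Var Act N) (α : Multiset (MAct D Var Act)) :
      MTrans mspec γ P α P' → MTrans mspec γ (.choice P Q) α P'
  | sumR (P Q Q' : MProc D Var Act N) (α : Multiset (MAct D Var Act)) :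
      MTrans mspec γ Q α Q' → MTrans mspec γ (.choice P Q) α Q'
  | name (n : N) (α : Multiset (MAct D Var Act)) (P' : MProc D Var Act N) :
      MTrans mspec γ (mspec n) α P' → MTrans mspec γ (.name n) α P'
  | parL (P Q P' : MProc D Var Act N) (α : Multiset (MAct D Var Act)) :
      MTrans mspec γ P α P' → MTrans mspec γ (.par P Q) α (.par P' Q)
  | parR (P Q Q' : MProc D Var Act N) (α : Multiset (MAct D Var Act)) :
      MTrans mspec γ Q α Q' → MTrans mspec γ (.par P Q) α (.par P Q')
  | parC (P Q P' Q' : MProc D Var Act N) (α β : Multiset (MAct D Var Act)) :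
      MTrans mspec γ P α P' → MTrans mspec γ Q β Q' →
      MTrans mspec γ (.par P Q) (α + β) (.par P' Q')
  | sum (f : D → MProc D Var Act N) (d : D) (α : Multiset (MAct D Var Act))
      (P' : MProc D Var Act N) :
      MTrans mspec γ (f d) α P' → MTrans mspec γ (.sum f) α P'
  | hide (I : Set (MName Act)) (P P' : MProc D Var Act N) (α : Multiset (MAct D Var Act)) :
      MTrans mspec γ P α P' → MTrans mspec γ (.hide I P) (hideM I α) (.hide I P')
  | comm (P P' : MProc D Var Act N) (α β : Multiset (MAct D Var Act)) :
      MTrans mspec γ P α P' → CommApply γ α β → MTrans mspec γ (.comm P) β (.comm P')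
  | allow (M : Set (Multiset (MName Act))) (P P' : MProc D Var Act N)
      (α : Multiset (MAct D Var Act)) :
      MTrans mspec γ P α P' → α.map MAct.name ∈ M →
      MTrans mspec γ (.allow M P) α (.allow M P')

/-! ## Sequential and parallel-sequential process expressions, and the translation -/

/-- Sequential process expressions (the domain of the translation `χ`). -/
inductive SeqExp (D Var Act PN : Type) : Type
  | choice : SeqExp D Var Act PN → SeqExp D Var Act PN → SeqExp D Var Act PN
  | cond : Var → D → SeqExp D Var Act PN → SeqExp D Var Act PN
  | pre : Label D Var Act → SeqExp D Var Act PN → SeqExp D Var Act PN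
  | delta : SeqExp D Var Act PN
  | name : PN → SeqExp D Var Act PN

/-- Parallel-sequential process expressions. -/
inductive ParExp (D Var Act PN : Type) : Type
  | par : ParExp D Var Act PN → ParExp D Var Act PN → ParExp D Var Act PN
  | name : PN → ParExp D Var Act PN
  | seq : SeqExp D Var Act PN → ParExp D Var Act PN

/-- The embedding of sequential expressions into process expressions. -/
def SeqExp.toPExp : SeqExp D Var Act PN → PExp D Var Act PN
  | .choice P Q => .choice P.toPExp Q.toPExp
  | .cond v d P => .cond v d P.toPExp
  | .pre l P => .pre l P.toPExp
  | .delta => .delta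
  | .name X => .name X

/-- The embedding of parallel-sequential expressions into process expressions. -/
def ParExp.toPExp : ParExp D Var Act PN → PExp D Var Act PN
  | .par P Q => .par P.toPExp Q.toPExp
  | .name X => .name X
  | .seq P => P.toPExp

/-- The translation `χ` of sequential process expressions (over the single global
variable `g`, whence `Var = Unit`), parametrized by a finite set `ε ⊆ D` of constraints. -/
def chi [DecidableEq D] : SeqExp D Unit Act PN → Finset D → MProc D Unit Act (PN ⊕ D)
  | .choice P₁ P₂, ε => .choice (chi P₁ ε) (chi P₂ ε)
  | .cond _ d P₁, ε => chi P₁ (insert d ε)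
  | .pre (.act a) P₁, ε => .sum (fun d₁ =>
      .pre {MAct.act a, MAct.checkP d₁ (decide (∀ d ∈ ε, d₁ = d))} (chi P₁ ∅))
  | .pre (.assign v d') P₁, ε => .sum (fun d₁ =>
      .pre {MAct.assignP v d', MAct.checkP d₁ (decide (∀ d ∈ ε, d₁ = d))} (chi P₁ ∅))
  | .delta, _ => .delta
  | .name X, _ => .name (Sum.inl X)

/-- The defining body of the process `Globs(d : D)` tracking the global variable `g`. -/
def GlobsBody (d : D) : MProc D Unit Act (PN ⊕ D) :=
  .choice (.choice (.choice
    (.pre {MAct.checkG d true} (.name (Sum.inr d)))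
    (.pre {MAct.checkG d true, MAct.checkG d true} (.name (Sum.inr d))))
    (.sum (fun new => .pre {MAct.checkG d true, MAct.assignG () new} (.name (Sum.inr new)))))
    (.pre {MAct.value () d} (.name (Sum.inr d)))

/-- The translated recursive specification `E'`: the translation of the defining equation
for every process name of `E`, together with a defining equation for `Globs`. -/
def mspec [DecidableEq D] (spec : PN → SeqExp D Unit Act PN) :
    PN ⊕ D → MProc D Unit Act (PN ⊕ D)
  | Sum.inl X => chi (spec X) ∅
  | Sum.inr d => GlobsBody d

/-- The extension of `χ` to parallel-sequential process expressions. -/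
def chiPar [DecidableEq D] : ParExp D Unit Act PN → MProc D Unit Act (PN ⊕ D)
  | .par P₁ P₂ => .par (chiPar P₁) (chiPar P₂)
  | .name X => .name (Sum.inl X)
  | .seq P => chi P ∅

/-- The set `A_B = (Act ∖ B) ∪ {value, assign}` of allowed multi-action names. -/
def allowSet (B : Set Act) : Set (Multiset (MName Act)) :=
  {m | (∃ a : Act, a ∉ B ∧ m = {MName.act a}) ∨ m = {MName.assign} ∨ m = {MName.value}}

/-- The translation `Ψ(P,V) = ∇_{A_B}(τ_{{check}}(Γ_{C_{Gγ}}(χ(P,∅) ∥ Globs(V(g)))))`. -/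
def Psi [DecidableEq D] (B : Set Act) (P : ParExp D Unit Act PN) (V : Valuation D Unit) :
    MProc D Unit Act (PN ⊕ D) :=
  .allow (allowSet B) (.hide {MName.check} (.comm (.par (chiPar P) (.name (Sum.inr (V ()))))))

/-- The embedding of the transition labels `TL` as semantic multi-actions. -/
def labelToM : Label D Var Act → Multiset (MAct D Var Act)
  | .act a => {MAct.act a}
  | .assign v d => {MAct.assign v d}

/-! ## Variable consistency and translation of formulas -/

/-- Variable consistency of an LTS `(S₂, →₂, s₂)` over mCRL2 process expressions with an
LTS `(S₁, →₁, s₁)` whose states are pairs of a process expression and a valuation,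
via a mapping `ℓ : S₁ → S₂`. -/
structure VarConsistent {Pr S₂ : Type}
    (tr₁ : (Pr × Valuation D Var) → Label D Var Act → (Pr × Valuation D Var) → Prop)
    (s₁ : Pr × Valuation D Var)
    (tr₂ : S₂ → Multiset (MAct D Var Act) → S₂ → Prop) (s₂ : S₂)
    (ℓ : (Pr × Valuation D Var) → S₂) : Prop where
  map_reach : ∀ s₁', ReachableState tr₁ s₁ s₁' → ReachableState tr₂ (ℓ s₁) (ℓ s₁')
  labels : ∀ t₁ t₂ (α : Multiset (MAct D Var Act)),
    ReachableState tr₂ s₂ t₁ → ReachableState tr₂ s₂ t₂ → tr₂ t₁ α t₂ →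
    (∃ l : Label D Var Act, α = labelToM l) ∨ (∃ (v : Var) (d : D), α = {MAct.value v d})
  value_loops : ∀ (P : Pr) (V : Valuation D Var) (s' : S₂) (v : Var) (d : D),
    tr₂ (ℓ (P, V)) {MAct.value v d} s' ↔ (V v = d ∧ s' = ℓ (P, V))
  steps : ∀ (l : Label D Var Act) (s₁' s₂' : Pr × Valuation D Var),
    ReachableState tr₁ s₁ s₁' → ReachableState tr₁ s₁ s₂' →
    (tr₁ s₁' l s₂' ↔ tr₂ (ℓ s₁') (labelToM l) (ℓ s₂'))

/-- The translation `θ` of `HML^{check}` formulas into plain HML formulas: every check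
`(v = e)` is replaced by `⟨value(v,e)⟩ true`. -/
def theta {L L' : Type} (f : L → L') (valL : Var → D → L') : HMLc D Var L → HMLb L'
  | .tt => .tt
  | .ff => .ff
  | .check v e => .dia {valL v e} (Set.finite_singleton _) (Set.singleton_nonempty _) .tt
  | .neg φ => .neg (theta f valL φ)
  | .conj φ ψ => .conj (theta f valL φ) (theta f valL ψ)
  | .disj φ ψ => .disj (theta f valL φ) (theta f valL ψ)
  | .dia T hf hn φ => .dia (f '' T) (hf.image f) (hn.image f) (theta f valL φ)
  | .box T hf hn φ => .box (f '' T) (hf.image f) (hn.image f) (theta f valL φ)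

/-- Two states satisfy exactly the same `HML^{check}` formulas. -/
def HMLc.Equivalent {Pr L : Type}
    (tr : (Pr × Valuation D Var) → L → (Pr × Valuation D Var) → Prop)
    (s t : Pr × Valuation D Var) : Prop :=
  ∀ φ : HMLc D Var L, HMLc.Sat tr φ s ↔ HMLc.Sat tr φ t

section HennessyMilner

variable {Pr L : Type} {tr : (Pr × Valuation D Var) → L → (Pr × Valuation D Var) → Prop}

theorem HMLc.Equivalent.symm {s t : Pr × Valuation D Var} (h : HMLc.Equivalent tr s t) :
    HMLc.Equivalent tr t s :=
  fun φ => (h φ).symm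

theorem HMLc.Equivalent.valuation_eq {s t : Pr × Valuation D Var}
    (h : HMLc.Equivalent tr s t) : s.2 = t.2 :=
  funext fun v => ((h (.check v (s.2 v))).mp rfl).symm

theorem HMLc.exists_sat_not_sat_of_not_equivalent {s t : Pr × Valuation D Var}
    (h : ¬ HMLc.Equivalent tr s t) :
    ∃ φ : HMLc D Var L, HMLc.Sat tr φ s ∧ ¬ HMLc.Sat tr φ t := by
  obtain ⟨φ, hφ⟩ := not_forall.mp h
  by_cases hs : HMLc.Sat tr φ s
  · exact ⟨φ, hs, fun ht => hφ (iff_of_true hs ht)⟩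
  · exact ⟨.neg φ, hs, fun ht => hφ (iff_of_false hs ht)⟩

/-- A single formula separates a state from finitely many inequivalent states. -/
theorem HMLc.exists_sat_forall_not_sat {s : Pr × Valuation D Var}
    {A : Set (Pr × Valuation D Var)} (hA : A.Finite)
    (h : ∀ t ∈ A, ¬ HMLc.Equivalent tr s t) :
    ∃ φ : HMLc D Var L, HMLc.Sat tr φ s ∧ ∀ t ∈ A, ¬ HMLc.Sat tr φ t := by
  induction A, hA using Set.Finite.induction_on with
  | empty => exact ⟨.tt, trivial, fun t ht => ht.elim⟩
  | insert _ _ ih =>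
    obtain ⟨φ, hφs, hφ⟩ := ih fun t ht => h t (Set.mem_insert_of_mem _ ht)
    obtain ⟨ψ, hψs, hψ⟩ :=
      HMLc.exists_sat_not_sat_of_not_equivalent (h _ (Set.mem_insert _ _))
    refine ⟨.conj φ ψ, ⟨hφs, hψs⟩, ?_⟩
    rintro t (rfl | ht) hsat
    · exact hψ hsat.2
    · exact hφ t ht hsat.1

theorem HMLc.Equivalent.exists_trans {s t s' : Pr × Valuation D Var} {l : L}
    (h : HMLc.Equivalent tr s t) (ht : ImageFiniteState tr t) (hs : tr s l s') :
    ∃ t', tr t l t' ∧ HMLc.Equivalent tr s' t' := by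
  by_contra! hne
  obtain ⟨φ, hφs, hφ⟩ := HMLc.exists_sat_forall_not_sat (ht l) hne
  obtain ⟨_, rfl, t', htr, hsat⟩ :=
    (h (.dia {l} (Set.finite_singleton l) (Set.singleton_nonempty l) φ)).mp
      ⟨l, rfl, s', hs, hφs⟩
  exact hφ t' htr hsat

end HennessyMilner

/-- If all states reachable from `⟨P,V⟩` and `⟨Q,V⟩` are image-finite and `⟨P,V⟩` and
`⟨Q,V⟩` satisfy exactly the same `HML^{check}` formulas, then they are state-based
bisimilar. -/
theorem statement6 {D Var Act PN : Type} [DecidableEq Var] [Finite Var]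
    (spec : PN → PExp D Var Act PN) (hspec : Guarded spec)
    (γ : CommFun Act) (hγc : CommFun.Commutative γ) (hγa : CommFun.Associative γ)
    (hγh : CommFun.Handshaking γ)
    (P Q : PExp D Var Act PN) (V : Valuation D Var)
    (hP : ∀ s, ReachableState (STrans spec γ) (P, V) s → ImageFiniteState (STrans spec γ) s)
    (hQ : ∀ s, ReachableState (STrans spec γ) (Q, V) s → ImageFiniteState (STrans spec γ) s)
    (h : ∀ φ : HMLc D Var (Label D Var Act),
      HMLc.Sat (STrans spec γ) φ (P, V) ↔ HMLc.Sat (STrans spec γ) φ (Q, V)) :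
    StateBasedBisimilar spec γ (P, V) (Q, V) := by
  have reach_step : ∀ {s s' : GState D Var Act PN} {l : Label D Var Act},
      STrans spec γ s l s' →
      (∀ u, ReachableState (STrans spec γ) s u → ImageFiniteState (STrans spec γ) u) →
      ∀ u, ReachableState (STrans spec γ) s' u → ImageFiniteState (STrans spec γ) u :=
    fun htr hs u hu => hs u (Relation.ReflTransGen.head ⟨_, htr⟩ hu)
  refine ⟨fun s t => HMLc.Equivalent (STrans spec γ) s t ∧
    (∀ u, ReachableState (STrans spec γ) s u → ImageFiniteState (STrans spec γ) u) ∧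
    (∀ u, ReachableState (STrans spec γ) t u → ImageFiniteState (STrans spec γ) u),
    ?_, h, hP, hQ⟩
  rintro P₁ V₁ Q₁ V₂ ⟨heq, hs, ht⟩
  refine ⟨heq.valuation_eq, fun l V' => ⟨fun P' htr => ?_, fun Q' htr => ?_⟩⟩
  · have hstep : STrans spec γ (P₁, V₁) l (P', V') := htr
    obtain ⟨⟨Q', W⟩, htr', heq'⟩ := heq.exists_trans (ht _ .refl) hstep
    obtain rfl : V' = W := heq'.valuation_eq
    exact ⟨Q', htr', heq', reach_step hstep hs, reach_step htr' ht⟩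
  · have hstep : STrans spec γ (Q₁, V₂) l (Q', V') := htr
    obtain ⟨⟨P', W⟩, htr', heq'⟩ := heq.symm.exists_trans (hs _ .refl) hstep
    obtain rfl : V' = W := heq'.valuation_eq
    exact ⟨P', htr', heq'.symm, reach_step htr' hs, reach_step hstep ht⟩

end GlobalVars
end

section
/- For any two process expressions P and Q of the process algebra with global variables, if P and Q are stateless bisimilar then ⟨P,V⟩ and ⟨Q,V⟩ are state-based bisimilar for every valuation V. -/
namespace GlobalVars

open scoped Classical

variable {D Var Act PN : Type}

/-- If `P` and `Q` are stateless bisimilar then `⟨P,V⟩` and `⟨Q,V⟩` are state-based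
bisimilar for every valuation `V`. -/
theorem statement7 {D Var Act PN : Type} [DecidableEq Var] [Finite Var]
    (spec : PN → PExp D Var Act PN) (hspec : Guarded spec)
    (γ : CommFun Act) (hγc : CommFun.Commutative γ) (hγa : CommFun.Associative γ)
    (hγh : CommFun.Handshaking γ)
    (P Q : PExp D Var Act PN)
    (h : StatelessBisimilar spec γ P Q) :
    ∀ V : Valuation D Var, StateBasedBisimilar spec γ (P, V) (Q, V) := by
  obtain ⟨R, hR, hPQ⟩ := h
  intro V
  refine ⟨fun s t => R s.1 t.1 ∧ s.2 = t.2, ?_, hPQ, rfl⟩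
  rintro P₁ V₁ Q₁ V₂ ⟨hR₁, rfl : V₁ = V₂⟩
  refine ⟨rfl, fun l V' => ⟨fun P' hP' => ?_, fun Q' hQ' => ?_⟩⟩
  · obtain ⟨Q', hQ', hR'⟩ := (hR P₁ Q₁ hR₁ l V₁ V').1 P' hP'
    exact ⟨Q', hQ', hR', rfl⟩
  · obtain ⟨P', hP', hR'⟩ := (hR P₁ Q₁ hR₁ l V₁ V').2 Q' hQ'
    exact ⟨P', hP', hR', rfl⟩

end GlobalVars
end

section
/- For all parallel-sequential process expressions P, mCRL2 process expressions P', valuations V, d ∈ D, and B ⊆ Act: Ψ(P,V) —value(g,d)→ P' if and only if V(g) = d and P' = Ψ(P,V). -/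
namespace GlobalVars

open scoped Classical

variable {D Var Act PN : Type}

/-- An action label that stems from a sequential process and is not consumed by the
communication of checks. -/
def MAct.IsProcAct : MAct D Var Act → Prop
  | .act _ => True
  | .assignP _ _ => True
  | .assign _ _ => True
  | _ => False

/-- Every initial multi-action of the process contains a process action, and every unguarded
process name is a translated one. -/
def MProc.ProcHeaded : MProc D Var Act (PN ⊕ D) → Prop
  | .pre α _ => ∃ a ∈ α, a.IsProcAct
  | .delta => True
  | .choice P Q => P.ProcHeaded ∧ Q.ProcHeaded
  | .par P Q => P.ProcHeaded ∧ Q.ProcHeaded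
  | .name n => ∃ X, n = Sum.inl X
  | .sum f => ∀ d, (f d).ProcHeaded
  | _ => False

theorem chi_procHeaded [DecidableEq D] (P : SeqExp D Unit Act PN) (ε : Finset D) :
    (chi P ε).ProcHeaded := by
  induction P generalizing ε with
  | choice P Q ihP ihQ => exact ⟨ihP ε, ihQ ε⟩
  | cond v d P ih => exact ih _
  | pre l P _ =>
    cases l with
    | act a => exact fun d => ⟨MAct.act a, by simp, trivial⟩
    | assign v d' => exact fun d => ⟨MAct.assignP v d', by simp, trivial⟩
  | delta => trivial
  | name X => exact ⟨X, rfl⟩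

theorem chiPar_procHeaded [DecidableEq D] (P : ParExp D Unit Act PN) :
    (chiPar P).ProcHeaded := by
  induction P with
  | par P Q ihP ihQ => exact ⟨ihP, ihQ⟩
  | name X => exact ⟨X, rfl⟩
  | seq P => exact chi_procHeaded P ∅

theorem MTrans.exists_isProcAct [DecidableEq D] {spec : PN → SeqExp D Unit Act PN}
    {γ : CommFun Act} {P P' : MProc D Unit Act (PN ⊕ D)} {α : Multiset (MAct D Unit Act)}
    (h : MTrans (mspec spec) γ P α P') (hP : P.ProcHeaded) : ∃ a ∈ α, a.IsProcAct := by
  induction h with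
  | pre α P => exact hP
  | sumL P Q P' α _ ih => exact ih hP.1
  | sumR P Q Q' α _ ih => exact ih hP.2
  | name n α P' _ ih =>
    obtain ⟨X, rfl⟩ := hP
    exact ih (chi_procHeaded (spec X) ∅)
  | parL P Q P' α _ ih => exact ih hP.1
  | parR P Q Q' α _ ih => exact ih hP.2
  | parC P Q P' Q' α β _ _ ihP _ =>
    obtain ⟨a, ha, h⟩ := ihP hP.1
    exact ⟨a, Multiset.mem_add.2 (Or.inl ha), h⟩
  | sum f d α P' _ ih => exact ih (hP d)
  | hide => exact hP.elim
  | comm => exact hP.elim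
  | allow => exact hP.elim

theorem CommStep.exists_isProcAct {γ : CommFun Act} {α β : Multiset (MAct D Var Act)}
    (h : CommStep γ α β) (hα : ∃ a ∈ α, a.IsProcAct) : ∃ a ∈ β, a.IsProcAct := by
  cases h with
  | act a b c rest _ => exact ⟨MAct.act c, by simp, trivial⟩
  | assign v d rest => exact ⟨MAct.assign v d, by simp, trivial⟩
  | check d b rest =>
    obtain ⟨a, ha, h⟩ := hα
    rcases Multiset.mem_cons.1 ha with rfl | ha
    · exact h.elim
    rcases Multiset.mem_cons.1 ha with rfl | ha
    · exact h.elim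
    exact ⟨a, Multiset.mem_cons_of_mem ha, h⟩

theorem CommStep.value_mem_iff {γ : CommFun Act} {α β : Multiset (MAct D Var Act)}
    (h : CommStep γ α β) (v : Var) (d : D) : MAct.value v d ∈ β ↔ MAct.value v d ∈ α := by
  cases h <;> simp

theorem CommApply.exists_isProcAct {γ : CommFun Act} {α β : Multiset (MAct D Var Act)}
    (h : CommApply γ α β) (hα : ∃ a ∈ α, a.IsProcAct) : ∃ a ∈ β, a.IsProcAct := by
  obtain ⟨hsteps, -⟩ := h
  induction hsteps with
  | refl => exact hα
  | tail _ hstep ih => exact hstep.exists_isProcAct ih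

theorem CommApply.value_mem_iff {γ : CommFun Act} {α β : Multiset (MAct D Var Act)}
    (h : CommApply γ α β) (v : Var) (d : D) : MAct.value v d ∈ β ↔ MAct.value v d ∈ α := by
  obtain ⟨hsteps, -⟩ := h
  induction hsteps with
  | refl => rfl
  | tail _ hstep ih => exact (hstep.value_mem_iff v d).trans ih

theorem commApply_value (γ : CommFun Act) (v : Var) (d : D) :
    CommApply γ {MAct.value v d} {MAct.value v d} := by
  refine ⟨.refl, fun β' h => ?_⟩
  generalize hα : ({MAct.value v d} : Multiset (MAct D Var Act)) = α at h
  cases h <;> simpa using congrArg Multiset.card hα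

theorem MAct.IsProcAct.name_ne_check {a : MAct D Var Act} (h : a.IsProcAct) :
    a.name ≠ MName.check := by
  cases a <;> simp_all [MAct.IsProcAct, MAct.name]

/-- The only transition of `Globs` whose label contains `value` is the self-loop. -/
theorem MTrans.globs_value [DecidableEq D] {spec : PN → SeqExp D Unit Act PN}
    {γ : CommFun Act} {e d : D} {Q : MProc D Unit Act (PN ⊕ D)}
    {α : Multiset (MAct D Unit Act)} (h : MTrans (mspec spec) γ (.name (Sum.inr e)) α Q)
    (hd : MAct.value () d ∈ α) : e = d ∧ Q = .name (Sum.inr e) := by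
  cases h with | name _ _ _ h => ?_
  change MTrans _ _ (GlobsBody e) _ _ at h
  cases h with
  | sumR _ _ _ _ h => cases h; simp_all
  | sumL _ _ _ _ h =>
    cases h with
    | sumR _ _ _ _ h => cases h with | sum _ _ _ _ h => cases h; simp at hd
    | sumL _ _ _ _ h =>
      cases h with
      | sumL _ _ _ _ h => cases h; simp at hd
      | sumR _ _ _ _ h => cases h; simp at hd

/-- Lemma 2: `Ψ(P,V) —value(g,d)→ P'` iff `V(g) = d` and `P' = Ψ(P,V)`. -/
theorem statement9 {D Act PN : Type} [DecidableEq D]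
    (spec : PN → SeqExp D Unit Act PN) (hspec : Guarded (fun X => (spec X).toPExp))
    (γ : CommFun Act) (hγc : CommFun.Commutative γ) (hγa : CommFun.Associative γ)
    (hγh : CommFun.Handshaking γ)
    (B : Set Act) (P : ParExp D Unit Act PN) (P' : MProc D Unit Act (PN ⊕ D))
    (V : Valuation D Unit) (d : D) :
    MTrans (mspec spec) γ (Psi B P V) {MAct.value () d} P' ↔
      (V () = d ∧ P' = Psi B P V) := by
  constructor
  · intro h
    unfold Psi at h
    generalize hl : ({MAct.value () d} : Multiset (MAct D Unit Act)) = l at h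
    cases h with | allow _ _ _ _ h _ => ?_
    cases h with | hide _ _ _ α h => ?_
    cases h with | comm _ _ α' _ h hcomm => ?_
    have hno : ¬ ∃ a ∈ α', a.IsProcAct := by
      intro hα'
      obtain ⟨a, ha, hp⟩ := hcomm.exists_isProcAct hα'
      have hmem : a ∈ hideM {MName.check} α :=
        Multiset.mem_filter.2 ⟨ha, hp.name_ne_check⟩
      rw [← hl, Multiset.mem_singleton] at hmem
      subst hmem
      exact hp
    have hval : MAct.value () d ∈ α' := by
      have hmem : MAct.value () d ∈ hideM {MName.check} α := by simp [← hl]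
      exact (hcomm.value_mem_iff () d).1 (Multiset.mem_filter.1 hmem).1
    cases h with
    | parL _ _ _ _ h => exact (hno (h.exists_isProcAct (chiPar_procHeaded P))).elim
    | parR _ _ _ _ h =>
      obtain ⟨he, rfl⟩ := h.globs_value hval
      exact ⟨he, rfl⟩
    | parC _ _ _ _ β _ h _ =>
      obtain ⟨a, ha, hp⟩ := h.exists_isProcAct (chiPar_procHeaded P)
      exact (hno ⟨a, Multiset.mem_add.2 (Or.inl ha), hp⟩).elim
  · rintro ⟨rfl, rfl⟩
    have hglobs : MTrans (mspec spec) γ (.name (Sum.inr (V ()))) {MAct.value () (V ())}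
        (.name (Sum.inr (V ()))) :=
      .name _ _ _ (.sumR _ _ _ _ (.pre _ _))
    have hhide : hideM {MName.check} ({MAct.value () (V ())} : Multiset (MAct D Unit Act)) =
        {MAct.value () (V ())} := by
      simp [hideM, MAct.name, Multiset.filter_singleton]
    have h := MTrans.hide {MName.check} _ _ _
      (.comm _ _ _ _ (.parR (chiPar P) _ _ _ hglobs) (commApply_value γ () (V ())))
    rw [hhide] at h
    exact .allow _ _ _ _ h (Or.inr (Or.inr (by simp [MAct.name])))

end GlobalVars
end

section
/- For all sequential process expressions P, mCRL2 process expressions P', labels λ ∈ Act ∪ {assignP(g,d) | d ∈ D}, and d1 ∈ D: if χ(P,∅) —λ|checkP(d1,true)→ P' in the mCRL2 semantics, then there exists a sequential process expression P'' such that χ(P'',∅) = P'. -/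
namespace GlobalVars

open scoped Classical

variable {D Var Act PN : Type}

/-- Expressions built from choices, sums, `δ`, names of sequential processes and prefixes of
translated sequential expressions. -/
def IsTranslated [DecidableEq D] : MProc D Unit Act (PN ⊕ D) → Prop
  | .pre _ Q => ∃ P : SeqExp D Unit Act PN, chi P ∅ = Q
  | .delta => True
  | .choice Q₁ Q₂ => IsTranslated Q₁ ∧ IsTranslated Q₂
  | .sum f => ∀ d, IsTranslated (f d)
  | .name n => ∃ X, n = Sum.inl X
  | _ => False

theorem isTranslated_chi [DecidableEq D] (P : SeqExp D Unit Act PN) (ε : Finset D) :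
    IsTranslated (chi P ε) := by
  induction P generalizing ε with
  | choice P₁ P₂ ih₁ ih₂ => exact ⟨ih₁ ε, ih₂ ε⟩
  | cond v d P₁ ih => exact ih _
  | pre l P₁ _ => cases l <;> exact fun d => ⟨P₁, rfl⟩
  | delta => trivial
  | name X => exact ⟨X, rfl⟩

theorem IsTranslated.exists_chi_eq_of_mTrans [DecidableEq D]
    {spec : PN → SeqExp D Unit Act PN} {γ : CommFun Act}
    {Q Q' : MProc D Unit Act (PN ⊕ D)} {α : Multiset (MAct D Unit Act)}
    (hQ : IsTranslated Q) (h : MTrans (mspec spec) γ Q α Q') :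
    ∃ P : SeqExp D Unit Act PN, chi P ∅ = Q' := by
  induction h with
  | pre α Q => exact hQ
  | sumL Q₁ Q₂ Q' α _ ih => exact ih hQ.1
  | sumR Q₁ Q₂ Q' α _ ih => exact ih hQ.2
  | name n α Q' _ ih =>
    obtain ⟨X, rfl⟩ := hQ
    exact ih (isTranslated_chi (spec X) ∅)
  | sum f d α Q' _ ih => exact ih (hQ d)
  | parL | parR | parC | hide | comm | allow => exact hQ.elim

/-- Lemma 3: if `χ(P,∅) —λ|checkP(d₁,true)→ P'` for `λ ∈ Act ∪ {assignP(g,d) | d ∈ D}`,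
then `P' = χ(P'',∅)` for some sequential process expression `P''`. -/
theorem statement10 {D Act PN : Type} [DecidableEq D]
    (spec : PN → SeqExp D Unit Act PN) (hspec : Guarded (fun X => (spec X).toPExp))
    (γ : CommFun Act) (hγc : CommFun.Commutative γ) (hγa : CommFun.Associative γ)
    (hγh : CommFun.Handshaking γ)
    (P : SeqExp D Unit Act PN) (P' : MProc D Unit Act (PN ⊕ D))
    (l : MAct D Unit Act)
    (hl : (∃ a : Act, l = MAct.act a) ∨ ∃ d : D, l = MAct.assignP () d)
    (d₁ : D)
    (h : MTrans (mspec spec) γ (chi P ∅) {l, MAct.checkP d₁ true} P') :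
    ∃ P'' : SeqExp D Unit Act PN, chi P'' ∅ = P' := by
  exact (isTranslated_chi P ∅).exists_chi_eq_of_mTrans h

end GlobalVars
end

section
/- For all parallel-sequential process expressions P, valuations V, and multi-actions α: if Ψ(P,V) —α→ P' in the mCRL2 semantics, then there exist a parallel-sequential process expression P'' and a valuation V' such that Ψ(P'',V') = P'. -/
namespace GlobalVars

open scoped Classical

variable {D Var Act PN : Type}

/-- Transitions of a guarded sequential translation end in a translation without constraints. -/
theorem MTrans.target_of_chi_guarded {D Act PN : Type} [DecidableEq D]
    {spec : PN → SeqExp D Unit Act PN} {γ : CommFun Act} (S : SeqExp D Unit Act PN)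
    (hS : GuardedExp S.toPExp) {ε : Finset D} {α : Multiset (MAct D Unit Act)}
    {Q : MProc D Unit Act (PN ⊕ D)} (h : MTrans (mspec spec) γ (chi S ε) α Q) :
    ∃ S' : SeqExp D Unit Act PN, chi S' ∅ = Q := by
  induction S generalizing ε with
  | choice S₁ S₂ ih₁ ih₂ =>
    cases h with
    | sumL _ _ _ _ h => exact ih₁ hS.1 h
    | sumR _ _ _ _ h => exact ih₂ hS.2 h
  | cond v d S ih => exact ih hS h
  | pre l S ih =>
    cases l <;>
    · cases h with
      | sum _ _ _ _ h =>
        cases h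
        exact ⟨S, rfl⟩
  | delta => cases h
  | name X => exact hS.elim

/-- Transitions of a translated process name end in a translation without constraints. -/
theorem MTrans.target_of_name {D Act PN : Type} [DecidableEq D]
    {spec : PN → SeqExp D Unit Act PN} (hspec : Guarded (fun X => (spec X).toPExp))
    {γ : CommFun Act} {X : PN} {α : Multiset (MAct D Unit Act)}
    {Q : MProc D Unit Act (PN ⊕ D)} (h : MTrans (mspec spec) γ (.name (Sum.inl X)) α Q) :
    ∃ S' : SeqExp D Unit Act PN, chi S' ∅ = Q := by
  cases h with
  | name _ _ _ h => exact MTrans.target_of_chi_guarded (spec X) (hspec X) h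

/-- Transitions of any sequential translation end in a translation without constraints. -/
theorem MTrans.target_of_chi {D Act PN : Type} [DecidableEq D]
    {spec : PN → SeqExp D Unit Act PN} (hspec : Guarded (fun X => (spec X).toPExp))
    {γ : CommFun Act} (S : SeqExp D Unit Act PN) {ε : Finset D}
    {α : Multiset (MAct D Unit Act)} {Q : MProc D Unit Act (PN ⊕ D)}
    (h : MTrans (mspec spec) γ (chi S ε) α Q) :
    ∃ S' : SeqExp D Unit Act PN, chi S' ∅ = Q := by
  induction S generalizing ε with
  | choice S₁ S₂ ih₁ ih₂ =>
    cases h with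
    | sumL _ _ _ _ h => exact ih₁ h
    | sumR _ _ _ _ h => exact ih₂ h
  | cond v d S ih => exact ih h
  | pre l S ih => exact MTrans.target_of_chi_guarded (.pre l S) trivial h
  | delta => cases h
  | name X => exact MTrans.target_of_name hspec h

/-- Translations of parallel-sequential expressions are closed under transitions. -/
theorem MTrans.target_of_chiPar {D Act PN : Type} [DecidableEq D]
    {spec : PN → SeqExp D Unit Act PN} (hspec : Guarded (fun X => (spec X).toPExp))
    {γ : CommFun Act} (P : ParExp D Unit Act PN) {α : Multiset (MAct D Unit Act)}
    {Q : MProc D Unit Act (PN ⊕ D)} (h : MTrans (mspec spec) γ (chiPar P) α Q) :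
    ∃ P' : ParExp D Unit Act PN, chiPar P' = Q := by
  induction P generalizing α Q with
  | par P₁ P₂ ih₁ ih₂ =>
    cases h with
    | parL _ _ _ _ h =>
      obtain ⟨P', rfl⟩ := ih₁ h
      exact ⟨.par P' P₂, rfl⟩
    | parR _ _ _ _ h =>
      obtain ⟨P', rfl⟩ := ih₂ h
      exact ⟨.par P₁ P', rfl⟩
    | parC _ _ _ _ _ _ h₁ h₂ =>
      obtain ⟨P₁', rfl⟩ := ih₁ h₁
      obtain ⟨P₂', rfl⟩ := ih₂ h₂
      exact ⟨.par P₁' P₂', rfl⟩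
  | name X =>
    obtain ⟨S', rfl⟩ := MTrans.target_of_name hspec h
    exact ⟨.seq S', rfl⟩
  | seq S =>
    obtain ⟨S', rfl⟩ := MTrans.target_of_chi hspec S h
    exact ⟨.seq S', rfl⟩

/-- Transitions of `Globs(d)` end in some `Globs(d')`. -/
theorem MTrans.target_of_globs {D Act PN : Type} [DecidableEq D]
    {spec : PN → SeqExp D Unit Act PN} {γ : CommFun Act} {d : D}
    {α : Multiset (MAct D Unit Act)} {Q : MProc D Unit Act (PN ⊕ D)}
    (h : MTrans (mspec spec) γ (.name (Sum.inr d)) α Q) :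
    ∃ d' : D, .name (Sum.inr d') = Q := by
  cases h with
  | name _ _ _ h =>
    cases h with
    | sumL _ _ _ _ h =>
      cases h with
      | sumL _ _ _ _ h => cases h with
        | sumL _ _ _ _ h => cases h; exact ⟨d, rfl⟩
        | sumR _ _ _ _ h => cases h; exact ⟨d, rfl⟩
      | sumR _ _ _ _ h => cases h with
        | sum _ d' _ _ h => cases h; exact ⟨d', rfl⟩
    | sumR _ _ _ _ h => cases h; exact ⟨d, rfl⟩

/-- Lemma 4: every transition of `Ψ(P,V)` ends in a state of the shape `Ψ(P'',V')` for
some parallel-sequential process expression `P''` and valuation `V'`. -/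
theorem statement11 {D Act PN : Type} [DecidableEq D]
    (spec : PN → SeqExp D Unit Act PN) (hspec : Guarded (fun X => (spec X).toPExp))
    (γ : CommFun Act) (hγc : CommFun.Commutative γ) (hγa : CommFun.Associative γ)
    (hγh : CommFun.Handshaking γ)
    (B : Set Act) (P : ParExp D Unit Act PN) (P' : MProc D Unit Act (PN ⊕ D))
    (V : Valuation D Unit) (α : Multiset (MAct D Unit Act))
    (h : MTrans (mspec spec) γ (Psi B P V) α P') :
    ∃ (P'' : ParExp D Unit Act PN) (V' : Valuation D Unit), Psi B P'' V' = P' := by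
  cases h with
  | allow _ _ _ _ h _ => cases h with
    | hide _ _ _ _ h => cases h with
      | comm _ _ _ _ h _ => cases h with
        | parL _ _ _ _ h =>
          obtain ⟨P'', rfl⟩ := MTrans.target_of_chiPar hspec P h
          exact ⟨P'', V, rfl⟩
        | parR _ _ _ _ h =>
          obtain ⟨d, rfl⟩ := MTrans.target_of_globs h
          exact ⟨P, fun _ => d, rfl⟩
        | parC _ _ _ _ _ _ h₁ h₂ =>
          obtain ⟨P'', rfl⟩ := MTrans.target_of_chiPar hspec P h₁
          obtain ⟨d, rfl⟩ := MTrans.target_of_globs h₂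
          exact ⟨P'', fun _ => d, rfl⟩

end GlobalVars
end
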